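/- Let n ≥ 1, let K be a tensor product of columns of lengths ℓ₁ ≤ … ≤ ℓ_r, let ℓ ∈ [n] with ℓ ≥ ℓ_r, and let j ∈ [n−1]. In the type GL_n affine Hecke algebra write tT_j⁻¹ (Σ_{C ∈ B(ϖ_ℓ)} X^{⃗C} Ψ_{C⊗K}) = Σ_{D ∈ B(ϖ_ℓ)} X^{⃗D} f_{D,K} and T_j (Σ_{C ∈ B(ϖ_ℓ)} X^{⃗C} Ψ_{C⊗K}) = Σ_{D ∈ B(ϖ_ℓ)} X^{⃗D} g_{D,K} with f_{D,K}, g_{D,K} ∈ H_n. Then: f_{D,K} = tT_j⁻¹ Ψ_{s_jD⊗K} if s_jD ≤ D, and f_{D,K} = T_j Ψ_{s_jD⊗K} + (1−t)Ψ_{D⊗K} if s_jD ≥ D; g_{D,K} = tT_j⁻¹ Ψ_{s_jD⊗K} − (1−t)Ψ_{D⊗K} if s_jD ≤ D, and g_{D,K} = T_j Ψ_{s_jD⊗K} if s_jD ≥ D. -/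

import Mathlib

set_option maxHeartbeats 1000000

attribute [local instance] Classical.propDecidable

noncomputable section

namespace HLHecke

/-- The base ring `ℤ[t^{±1}]` of Laurent polynomials. -/
abbrev HR : Type := LaurentPolynomial ℤ

/-- The parameter `t`. -/
def tt : HR := LaurentPolynomial.T 1

/-! ### The symmetric group on `Fin n` -/

/-- The simple transposition `s_j = (j, j+1)` (junk value `1` if out of range). -/
def sgen (n : ℕ) (j : ℕ) : Equiv.Perm (Fin n) :=
  if h : j + 1 < n then Equiv.swap ⟨j, Nat.lt_of_succ_lt h⟩ ⟨j + 1, h⟩ else 1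

/-- The product `s_{i₁} ⋯ s_{i_ℓ}` of a word `l = [i₁, …, i_ℓ]`. -/
def wordProd (n : ℕ) (l : List ℕ) : Equiv.Perm (Fin n) := (l.map (sgen n)).prod

/-- The action of `S_n` on `ℤⁿ` by permutation of coordinates. -/
def wAct (n : ℕ) (w : Equiv.Perm (Fin n)) (μ : Fin n → ℤ) : Fin n → ℤ := fun i => μ (w⁻¹ i)

/-- The standard inner product on `ℤⁿ`. -/
def ip (n : ℕ) (μ ν : Fin n → ℤ) : ℤ := ∑ i, μ i * ν i

/-- The standard basis vector `ε_i`. -/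
def eps (n : ℕ) (i : Fin n) : Fin n → ℤ := fun k => if k = i then 1 else 0

/-- The simple root `α_j = ε_j − ε_{j+1}` (0-indexed: entries `j` and `j+1` of `Fin n`). -/
def alpha (n : ℕ) (j : ℕ) : Fin n → ℤ :=
  fun i => if (i : ℕ) = j then 1 else if (i : ℕ) = j + 1 then -1 else 0

/-- The fundamental weight `ϖ_k = ε₁ + … + ε_k`. -/
def varpi (n : ℕ) (k : ℕ) : Fin n → ℤ := fun i => if (i : ℕ) < k then 1 else 0

/-- The set of positive roots `R₊`. -/
def Rpos (n : ℕ) (β : Fin n → ℤ) : Prop := ∃ i j : Fin n, i < j ∧ β = eps n i - eps n j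

/-- The Coxeter length: minimal length of a word in the simple transpositions. -/
def len (n : ℕ) (w : Equiv.Perm (Fin n)) : ℕ :=
  sInf {k | ∃ l : List ℕ, (∀ j ∈ l, j + 1 < n) ∧ l.length = k ∧ wordProd n l = w}

/-- A choice of reduced word for `w`. -/
def redWord (n : ℕ) (w : Equiv.Perm (Fin n)) : List ℕ :=
  if h : ∃ l : List ℕ, (∀ j ∈ l, j + 1 < n) ∧ l.length = len n w ∧ wordProd n l = w
  then h.choose else []

/-! ### Columns -/

lemma col_card_le (n : ℕ) (C : Finset (Fin n)) : C.card ≤ n := by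
  simpa using Finset.card_le_univ C

/-- The minimal length coset representative `u_C` attached to a column `C`:
it sends `1, …, ℓ` to the entries of `C` in increasing order and `ℓ+1, …, n` to the
entries of the complement of `C` in increasing order. -/
def colPerm (n : ℕ) (C : Finset (Fin n)) : Equiv.Perm (Fin n) :=
  ((finCongr ((Nat.add_sub_cancel' (col_card_le n C)).symm)).trans
    finSumFinEquiv.symm).trans <|
  ((Equiv.sumCongr (C.orderIsoOfFin rfl).toEquiv
      ((Cᶜ.orderIsoOfFin (by simp [Finset.card_compl])).toEquiv)).trans <|
    (Equiv.sumCongr (Equiv.refl _) (Equiv.subtypeEquivRight (fun x => Finset.mem_compl))).trans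
      (Equiv.sumCompl (fun x => x ∈ C)))

/-- The `k`-th smallest entry of a column (0-indexed, as a natural number; junk `0` if
out of range). -/
def nth (n : ℕ) (C : Finset (Fin n)) (k : ℕ) : ℕ := ((C.sort (· ≤ ·)).map Fin.val).getD k 0

/-- The action of the simple transposition `s_j` on columns. -/
def sCol (n : ℕ) (j : ℕ) (C : Finset (Fin n)) : Finset (Fin n) := C.image (sgen n j)

/-- Semistandardness of the two-column filling `F ⊗ E` (`F` the left column):
entrywise `f_i ≤ e_i`. -/
def pairSS (n : ℕ) (F E : Finset (Fin n)) : Prop := ∀ k < E.card, nth n F k ≤ nth n E k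

/-- A filling by columns (leftmost column first) is semistandard iff all adjacent pairs are. -/
def isSSYT (n : ℕ) (L : List (Finset (Fin n))) : Prop := L.Chain' (pairSS n)

/-- The set `B(ϖ_ℓ)` of columns of length `ℓ`. -/
def colFinset (n : ℕ) (ℓ : ℕ) : Finset (Finset (Fin n)) := Finset.univ.filter fun C => C.card = ℓ

/-- The highest weight column `(1, …, k)`. -/
def hwCol (n : ℕ) (k : ℕ) : Finset (Fin n) := Finset.univ.filter fun x => (x : ℕ) < k

/-- The vector `⃗C ∈ ℤⁿ` attached to a column `C`. -/
def vecOf (n : ℕ) (C : Finset (Fin n)) : Fin n → ℤ := fun i => if i ∈ C then 1 else 0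

/-- The sign `σ^j_C`: `-1` if `j ∈ C` and `j+1 ∉ C`, and `+1` otherwise. -/
def sigmaSign (n : ℕ) (j : ℕ) (C : Finset (Fin n)) : ℤ :=
  if h : j + 1 < n then
    (if (⟨j, Nat.lt_of_succ_lt h⟩ : Fin n) ∈ C ∧ (⟨j + 1, h⟩ : Fin n) ∉ C then -1 else 1)
  else 1

/-! ### Shapes and tableaux -/

/-- The length `λ'_{j+1}` of the `(j+1)`-st column (0-indexed `j`) of the Young diagram
of a partition `λ`. -/
def shapeColLen (n : ℕ) (μ : Fin n → ℤ) (j : ℕ) : ℕ :=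
  (Finset.univ.filter fun i : Fin n => (j : ℤ) < μ i).card

/-- The number of columns of the Young diagram of a dominant weight. -/
def numCols (n : ℕ) (μ : Fin n → ℤ) : ℕ := Finset.univ.sup fun i : Fin n => (μ i).toNat

/-- The highest weight tableau `T⁰_μ`: row `i` is filled with `i`, i.e. its columns are the
highest weight columns. -/
def hwTableau (n : ℕ) (μ : Fin n → ℤ) : List (Finset (Fin n)) :=
  List.ofFn fun j : Fin (numCols n μ) => hwCol n (shapeColLen n μ (j : ℕ))

/-- The content vector of a tableau: `(wtVec T) i` is the number of entries equal to `i`. -/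
def wtVec (n : ℕ) (L : List (Finset (Fin n))) : Fin n → ℤ :=
  fun i => ((L.filter fun C => i ∈ C).length : ℤ)

/-! ### Macdonald's ψ statistic -/

/-- Number of entries `≤ i` in the column at position `p` (0-indexed from the left). -/
def colCount (n : ℕ) (L : List (Finset (Fin n))) (i p : ℕ) : ℕ :=
  ((L.getD p ∅).filter fun x => (x : ℕ) < i).card

/-- The factor `ψ_{T_{≤ i+1}/T_{≤ i}}` of Macdonald's ψ. -/
def stripFactor (n : ℕ) (L : List (Finset (Fin n))) (i : ℕ) : HR :=
  ∏ p ∈ Finset.range L.length,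
    if colCount n L (i + 1) p = colCount n L i p ∧
        colCount n L (i + 1) (p + 1) = colCount n L i (p + 1) + 1 then
      1 - tt ^ (colCount n L i p - colCount n L i (p + 1))
    else 1

/-- Macdonald's `ψ_T = ∏_{i=1}^{n-1} ψ_{T_{≤ i+1}/T_{≤ i}}` for a semistandard tableau. -/
def macPsi (n : ℕ) (L : List (Finset (Fin n))) : HR := ∏ i ∈ Finset.Ico 1 n, stripFactor n L i

/-- Macdonald's tableau statistic, extended by `0` to non-semistandard fillings. -/
def psiT (n : ℕ) (L : List (Finset (Fin n))) : HR := if isSSYT n L then macPsi n L else 0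

/-! ### The affine Hecke algebra -/

/-- Generators of the affine Hecke algebra. -/
inductive AGen (n : ℕ) : Type
  | T : ℕ → AGen n
  | X : Fin n → AGen n
  | Xinv : Fin n → AGen n

/-- The free algebra on the generators. -/
abbrev FA (n : ℕ) := FreeAlgebra HR (AGen n)

def fT (n : ℕ) (j : ℕ) : FA n := FreeAlgebra.ι HR (AGen.T j)
def fX (n : ℕ) (i : Fin n) : FA n := FreeAlgebra.ι HR (AGen.X i)
def fXi (n : ℕ) (i : Fin n) : FA n := FreeAlgebra.ι HR (AGen.Xinv i)

/-- The defining relations of the type `GL_n` affine Hecke algebra. -/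
inductive ARel (n : ℕ) : FA n → FA n → Prop
  | junk (j : ℕ) (h : ¬ j + 1 < n) : ARel n (fT n j) 1
  | quad (j : ℕ) (h : j + 1 < n) :
      ARel n (fT n j * fT n j) ((tt - 1) • fT n j + algebraMap HR (FA n) tt)
  | braid (j : ℕ) (h : j + 2 < n) :
      ARel n (fT n j * fT n (j + 1) * fT n j) (fT n (j + 1) * fT n j * fT n (j + 1))
  | commT (j k : ℕ) (hjk : j + 1 < k) (hk : k + 1 < n) :
      ARel n (fT n j * fT n k) (fT n k * fT n j)
  | commX (i i' : Fin n) : ARel n (fX n i * fX n i') (fX n i' * fX n i)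
  | XinvL (i : Fin n) : ARel n (fX n i * fXi n i) 1
  | XinvR (i : Fin n) : ARel n (fXi n i * fX n i) 1
  | TXT (j : ℕ) (h : j + 1 < n) :
      ARel n (fT n j * fX n ⟨j, Nat.lt_of_succ_lt h⟩ * fT n j) (tt • fX n ⟨j + 1, h⟩)
  | TXcomm (j : ℕ) (h : j + 1 < n) (i : Fin n) (hi1 : (i : ℕ) ≠ j) (hi2 : (i : ℕ) ≠ j + 1) :
      ARel n (fT n j * fX n i) (fX n i * fT n j)

/-- The type `GL_n` affine Hecke algebra. -/
abbrev H (n : ℕ) := RingQuot (ARel n)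

/-- The generator `T_j` of the (affine) Hecke algebra. -/
def Tg (n : ℕ) (j : ℕ) : H n := RingQuot.mkAlgHom HR (ARel n) (fT n j)

/-- The generator `X_i`. -/
def Xg (n : ℕ) (i : Fin n) : H n := RingQuot.mkAlgHom HR (ARel n) (fX n i)

/-- The generator `X_i⁻¹`. -/
def Xig (n : ℕ) (i : Fin n) : H n := RingQuot.mkAlgHom HR (ARel n) (fXi n i)

/-- The scalar `t` inside `H`. -/
def tH (n : ℕ) : H n := algebraMap HR (H n) tt

/-- The scalar `t^k` inside `H`. -/
def tpow (n : ℕ) (k : ℕ) : H n := algebraMap HR (H n) (tt ^ k)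

/-- The monomial `X^μ` for `μ ∈ ℤⁿ`. -/
def Xmon (n : ℕ) (μ : Fin n → ℤ) : H n :=
  (List.ofFn fun i : Fin n =>
    if 0 ≤ μ i then Xg n i ^ (μ i).toNat else Xig n i ^ (-μ i).toNat).prod

/-- The product `T_{i₁} ⋯ T_{i_ℓ}` of a word. -/
def TofWord (n : ℕ) (l : List ℕ) : H n := (l.map (Tg n)).prod

/-- The element `T_w`, defined via a choice of reduced word for `w`. -/
def Tw (n : ℕ) (w : Equiv.Perm (Fin n)) : H n := TofWord n (redWord n w)

/-- The finite Hecke symmetrizer `1₀ = Σ_{w ∈ S_n} T_w`. -/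
def one0 (n : ℕ) : H n := ∑ w : Equiv.Perm (Fin n), Tw n w

/-- The stabilizer `S_{n,λ}` as a finset. -/
def stabFinset (n : ℕ) (lam : Fin n → ℤ) : Finset (Equiv.Perm (Fin n)) :=
  Finset.univ.filter fun w => wAct n w lam = lam

/-- The parabolic symmetrizer `1_λ = Σ_{w ∈ S_{n,λ}} T_w`. -/
def onePara (n : ℕ) (lam : Fin n → ℤ) : H n := ∑ w ∈ stabFinset n lam, Tw n w

/-- The Poincaré polynomial `W_λ(t) = Σ_{w ∈ S_{n,λ}} t^{ℓ(w)}`. -/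
def Wlam (n : ℕ) (lam : Fin n → ℤ) : HR := ∑ w ∈ stabFinset n lam, tt ^ len n w

/-- The parabolic subalgebra `H_{n,λ}`, as the span of `{T_w : w ∈ S_{n,λ}}`. -/
def HparaM (n : ℕ) (lam : Fin n → ℤ) : Submodule HR (H n) :=
  Submodule.span HR (Tw n '' {w | wAct n w lam = lam})

/-- The finite Hecke algebra `H_n`, the subalgebra generated by the `T_j`. -/
def Hfin (n : ℕ) : Subalgebra HR (H n) := Algebra.adjoin HR (Set.range (Tg n))

/-- The coefficient `h_{C, S}` of the parabolic decomposition
`h = Σ_{F ∈ B(ϖ_ℓ)} T_{u_F} h_F` (defined via choice; it is unique). -/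
def paraCoeff (n : ℕ) (ℓ : ℕ) (h : H n) (C : Finset (Fin n)) : H n :=
  if hex : ∃ g : Finset (Fin n) → H n,
      (∀ F : Finset (Fin n), F.card = ℓ → g F ∈ HparaM n (varpi n ℓ)) ∧
      h = ∑ F ∈ colFinset n ℓ, Tw n (colPerm n F) * g F
  then hex.choose C else 0

/-- The elements `Ψ_T` of the finite Hecke algebra, defined by recursion on the columns of `T`
(leftmost column first).  By convention `Ψ` of the empty tableau is `1₀`. -/
def Psi (n : ℕ) : List (Finset (Fin n)) → H n
  | [] => one0 n
  | [C] => tpow n (len n (colPerm n C)) * Ring.inverse (Tw n (colPerm n C)⁻¹) *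
      onePara n (varpi n C.card)
  | C :: S => tpow n (len n (colPerm n C)) * Ring.inverse (Tw n (colPerm n C)⁻¹) *
      paraCoeff n C.card (Psi n S) C

end HLHecke
namespace HLHecke

/-! ### The induced module -/


lemma Tg_quad (n j : ℕ) (h : j + 1 < n) :
    Tg n j * Tg n j = (tt - 1) • Tg n j + algebraMap HR (H n) tt := by
  have := RingQuot.mkAlgHom_rel HR (ARel.quad (n := n) j h)
  simpa [Tg] using this

lemma Tg_junk (n j : ℕ) (h : ¬ j + 1 < n) : Tg n j = 1 := by
  have := RingQuot.mkAlgHom_rel HR (ARel.junk (n := n) j h)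
  simpa [Tg] using this

lemma Tg_braid (n j : ℕ) (h : j + 2 < n) :
    Tg n j * Tg n (j+1) * Tg n j = Tg n (j+1) * Tg n j * Tg n (j+1) := by
  have := RingQuot.mkAlgHom_rel HR (ARel.braid (n := n) j h)
  simpa [Tg] using this

lemma Tg_comm (n j k : ℕ) (hjk : j + 1 < k) (h : k + 1 < n) :
    Tg n j * Tg n k = Tg n k * Tg n j := by
  have := RingQuot.mkAlgHom_rel HR (ARel.commT (n := n) j k hjk h)
  simpa [Tg] using this

lemma Xg_comm (n : ℕ) (i k : Fin n) : Xg n i * Xg n k = Xg n k * Xg n i := by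
  have := RingQuot.mkAlgHom_rel HR (ARel.commX (n := n) i k)
  simpa [Xg] using this

lemma TXT' (n j : ℕ) (h : j + 1 < n) :
    Tg n j * Xg n ⟨j, Nat.lt_of_succ_lt h⟩ * Tg n j = tt • Xg n ⟨j+1, h⟩ := by
  have := RingQuot.mkAlgHom_rel HR (ARel.TXT (n := n) j h)
  simpa [Xg, Tg] using this

lemma TXc (n j : ℕ) (h : j + 1 < n) (i : Fin n) (hi1 : (i : ℕ) ≠ j) (hi2 : (i : ℕ) ≠ j + 1) :
    Tg n j * Xg n i = Xg n i * Tg n j := by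
  have := RingQuot.mkAlgHom_rel HR (ARel.TXcomm (n := n) j h i hi1 hi2)
  simpa [Xg, Tg] using this

abbrev MM (n : ℕ) (V : Type) [AddCommGroup V] [Module HR V] := (Fin n → ℤ) →₀ V

section gen
variable {V : Type} [AddCommGroup V] [Module HR V]

/-- Shift operator. -/
def shf (V : Type) [AddCommGroup V] [Module HR V] (n : ℕ) (δ : Fin n → ℤ) : Module.End HR (MM n V) :=
  Finsupp.lmapDomain (V) HR (fun μ => μ + δ)

@[simp] lemma shf_single (n : ℕ) (δ μ : Fin n → ℤ) (v : V) :
    shf V n δ (Finsupp.single μ v) = Finsupp.single (μ + δ) v := by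
  simp [shf]

lemma end_ext {n : ℕ} {A B : Module.End HR (MM n V)}
    (h : ∀ μ v, A (Finsupp.single μ v) = B (Finsupp.single μ v)) : A = B := by
  apply Finsupp.lhom_ext
  exact h

lemma shf_mul (n : ℕ) (δ ε : Fin n → ℤ) : shf V n δ * shf V n ε = shf V n (δ + ε) := by
  apply end_ext; intro μ v
  simp only [Module.End.mul_apply, shf_single]
  congr 1; abel

lemma shf_zero (n : ℕ) : shf V n 0 = 1 := by
  apply end_ext; intro μ v; simp

lemma single_add_shf (n : ℕ) (δ μ : Fin n → ℤ) (v : V) :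
   Finsupp.single (μ + δ) v = shf V n δ (Finsupp.single μ v) := by simp

abbrev ee (n : ℕ) (i : Fin n) : Fin n → ℤ := Pi.single i 1

lemma kill {n : ℕ} (B : Module.End HR (MM n V)) (h0 : ∀ v, B (Finsupp.single 0 v) = 0)
    (hc : ∀ i, ∃ k, B * shf V n (ee n i) = shf V n (ee n k) * B) : B = 0 := by
  let S : Set (Fin n → ℤ) := {μ | ∀ v, B (Finsupp.single μ v) = 0}
  let G : AddSubgroup (Fin n → ℤ) :=
    { carrier := {δ | ∀ μ, μ ∈ S ↔ μ + δ ∈ S}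
      zero_mem' := by intro μ; simp
      add_mem' := by
        intro a b ha hb μ
        rw [ha μ, hb (μ + a), add_assoc]
      neg_mem' := by
        intro a ha μ
        have := ha (μ + -a)
        rw [neg_add_cancel_right] at this
        exact this.symm }
  have hG : ∀ i, ee n i ∈ G := by
    intro i μ
    obtain ⟨k, hk⟩ := hc i
    have key : ∀ v, B (Finsupp.single (μ + ee n i) v) = shf V n (ee n k) (B (Finsupp.single μ v)) := by
      intro v
      rw [single_add_shf, ← Module.End.mul_apply, hk, Module.End.mul_apply]
    constructor
    · intro h v
      rw [key, h v, map_zero]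
    · intro h v
      have h2 := h v
      rw [key] at h2
      have h3 := congrArg (shf V n (-ee n k)) h2
      rwa [map_zero, ← Module.End.mul_apply, shf_mul, neg_add_cancel, shf_zero,
        Module.End.one_apply] at h3
  apply end_ext
  intro μ v
  have hμ : μ ∈ G := by
    have : μ = ∑ i, μ i • ee n i := by
      ext k
      simp [Finset.sum_apply, Pi.single_apply]
    rw [this]
    exact sum_mem fun i _ => G.zsmul_mem (hG i) _
  have := (hμ 0).1 h0
  rw [zero_add] at this
  simpa using this v

/-- the Demazure part -/
def dem (V : Type) [AddCommGroup V] [Module HR V] (n j : ℕ) (h : j + 1 < n) (μ : Fin n → ℤ) : V →ₗ[HR] MM n V :=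
  let a : Fin n := ⟨j, Nat.lt_of_succ_lt h⟩
  let b : Fin n := ⟨j+1, h⟩
  if 0 ≤ μ a - μ b then
    (1 - tt) • ∑ k ∈ Finset.range (μ a - μ b).toNat,
      Finsupp.lsingle (μ - ((k : ℤ) + 1) • (ee n a - ee n b))
  else (tt - 1) • ∑ k ∈ Finset.range (μ b - μ a).toNat,
      Finsupp.lsingle (μ + (k : ℤ) • (ee n a - ee n b))

/-- operator -/
def TM (τ : ℕ → Module.End HR V) (n j : ℕ) : Module.End HR (MM n V) :=
  if h : j + 1 < n then
    Finsupp.lsum HR fun μ =>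
      (Finsupp.lsingle (μ ∘ sgen n j)) ∘ₗ τ j + dem V n j h μ
  else 1

lemma TM_single (τ : ℕ → Module.End HR V) (n j : ℕ) (h : j + 1 < n) (μ : Fin n → ℤ) (v : V) :
    TM τ n j (Finsupp.single μ v) =
      Finsupp.single (μ ∘ sgen n j) (τ j v) + dem V n j h μ v := by
  rw [TM, dif_pos h]
  simp

lemma dem_zero (n j : ℕ) (h : j + 1 < n) : dem V n j h 0 = 0 := by
  simp [dem]

lemma TM_zero (τ : ℕ → Module.End HR V) (n j : ℕ) (hτ : ¬ j + 1 < n → τ j = 1) (v : V) :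
    TM τ n j (Finsupp.single 0 v) = Finsupp.single 0 (τ j v) := by
  by_cases h : j + 1 < n
  · rw [TM_single τ n j h, dem_zero]
    simp
  · rw [TM, dif_neg h, hτ h]; simp

lemma sgen_eq (n j : ℕ) (h : j + 1 < n) :
    sgen n j = Equiv.swap ⟨j, Nat.lt_of_succ_lt h⟩ ⟨j+1, h⟩ := by
  rw [sgen, dif_pos h]

lemma ee_comp (n j : ℕ) (i : Fin n) : ee n i ∘ sgen n j = ee n (sgen n j i) := by
  by_cases h : j + 1 < n
  · ext k
    rw [sgen_eq n j h]
    simp only [ee, Function.comp, Pi.single_apply]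
    congr 1
    rw [eq_iff_iff, Equiv.swap_apply_eq_iff]
  · simp [sgen, h]

lemma dem_c (n j : ℕ) (h : j + 1 < n) (i : Fin n) (hi1 : (i : ℕ) ≠ j) (hi2 : (i : ℕ) ≠ j + 1)
    (μ : Fin n → ℤ) (v : V) :
    dem V n j h (μ + ee n i) v = shf V n (ee n i) (dem V n j h μ v) := by
  have e1 : (⟨j, Nat.lt_of_succ_lt h⟩ : Fin n) ≠ i := fun e => hi1 (by rw [← e])
  have e2 : (⟨j+1, h⟩ : Fin n) ≠ i := fun e => hi2 (by rw [← e])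
  simp only [dem, Pi.add_apply, ee, Pi.single_eq_of_ne e1, Pi.single_eq_of_ne e2, add_zero]
  split_ifs
  · simp only [LinearMap.smul_apply, LinearMap.sum_apply, Finsupp.lsingle_apply, map_smul, map_sum,
      shf_single]
    congr 1; apply Finset.sum_congr rfl; intros; congr 1; abel
  · simp only [LinearMap.smul_apply, LinearMap.sum_apply, Finsupp.lsingle_apply, map_smul, map_sum,
      shf_single]
    congr 1; apply Finset.sum_congr rfl; intros; congr 1; abel

lemma dem_a (n j : ℕ) (h : j + 1 < n) (μ : Fin n → ℤ) (v : V) :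
    dem V n j h (μ + ee n ⟨j, Nat.lt_of_succ_lt h⟩) v = shf V n (ee n ⟨j+1,h⟩) (dem V n j h μ v)
      + (1 - tt) • Finsupp.single (μ + ee n ⟨j+1,h⟩) v := by
  set a : Fin n := ⟨j, Nat.lt_of_succ_lt h⟩ with ha
  set b : Fin n := ⟨j+1, h⟩ with hb
  have hab : a ≠ b := by simp [ha, hb]
  have E1 : (μ + ee n a) a = μ a + 1 := by simp
  have E2 : (μ + ee n a) b = μ b := by simp [hab]
  simp only [dem, ← ha, ← hb, E1, E2]
  rcases le_or_gt 0 (μ a - μ b) with hd | hd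
  · rw [if_pos (by omega), if_pos hd]
    have : (μ a + 1 - μ b).toNat = (μ a - μ b).toNat + 1 := by omega
    rw [this, Finset.sum_range_succ']
    simp only [LinearMap.smul_apply, LinearMap.sum_apply, LinearMap.add_apply,
      Finsupp.lsingle_apply, map_smul, map_sum, shf_single, smul_add]
    congr 2
    · apply Finset.sum_congr rfl; intros; congr 1; push_cast; module
    · congr 1; push_cast; module
  · rw [if_neg (by omega : ¬ 0 ≤ μ a - μ b)]
    obtain ⟨m, hm⟩ : ∃ m, (μ b - μ a).toNat = m + 1 := ⟨(μ b - μ a).toNat - 1, by omega⟩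
    have E : (if 0 ≤ μ a + 1 - μ b then
        (1 - tt) • ∑ k ∈ Finset.range (μ a + 1 - μ b).toNat,
          (Finsupp.lsingle (μ + ee n a - ((k : ℤ) + 1) • (ee n a - ee n b)) : V →ₗ[HR] MM n V)
        else (tt - 1) • ∑ k ∈ Finset.range (μ b - (μ a + 1)).toNat,
          Finsupp.lsingle (μ + ee n a + (k : ℤ) • (ee n a - ee n b))) =
        (tt - 1) • ∑ k ∈ Finset.range m,
          Finsupp.lsingle (μ + ee n a + (k : ℤ) • (ee n a - ee n b)) := by
      split_ifs with h0
      · have h1 : (μ a + 1 - μ b).toNat = 0 := by omega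
        have h2 : m = 0 := by omega
        rw [h1, h2]; simp
      · have h1 : (μ b - (μ a + 1)).toNat = m := by omega
        rw [h1]
    rw [E, hm, Finset.sum_range_succ']
    simp only [LinearMap.smul_apply, LinearMap.sum_apply, LinearMap.add_apply,
      Finsupp.lsingle_apply, map_smul, map_sum, map_add, shf_single, smul_add]
    have E3 : μ + ((0:ℕ):ℤ) • (ee n a - ee n b) + ee n b = μ + ee n b := by simp
    rw [E3, add_assoc, ← add_smul]
    have E4 : tt - 1 + (1 - tt) = 0 := by ring
    rw [E4, zero_smul, add_zero]
    congr 1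
    apply Finset.sum_congr rfl; intros; congr 1; push_cast; module

lemma dem_ab (n j : ℕ) (h : j + 1 < n) (μ : Fin n → ℤ) (v : V) :
    dem V n j h (μ + (ee n ⟨j, Nat.lt_of_succ_lt h⟩ + ee n ⟨j+1,h⟩)) v =
      shf V n (ee n ⟨j, Nat.lt_of_succ_lt h⟩ + ee n ⟨j+1,h⟩) (dem V n j h μ v) := by
  set a : Fin n := ⟨j, Nat.lt_of_succ_lt h⟩ with ha
  set b : Fin n := ⟨j+1, h⟩ with hb
  have hab : a ≠ b := by simp [ha, hb]
  have E1 : (μ + (ee n a + ee n b)) a = μ a + 1 := by simp [hab]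
  have E2 : (μ + (ee n a + ee n b)) b = μ b + 1 := by simp [hab]
  simp only [dem, ← ha, ← hb, E1, E2, add_sub_add_right_eq_sub]
  split_ifs
  · simp only [LinearMap.smul_apply, LinearMap.sum_apply, Finsupp.lsingle_apply, map_smul, map_sum,
      shf_single]
    congr 1; apply Finset.sum_congr rfl; intros; congr 1; abel
  · simp only [LinearMap.smul_apply, LinearMap.sum_apply, Finsupp.lsingle_apply, map_smul, map_sum,
      shf_single]
    congr 1; apply Finset.sum_congr rfl; intros; congr 1; abel

lemma add_comp' {n : ℕ} (μ ν : Fin n → ℤ) (s : Fin n → Fin n) :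
    (μ + ν) ∘ s = μ ∘ s + ν ∘ s := rfl

lemma sub_comp' {n : ℕ} (μ ν : Fin n → ℤ) (s : Fin n → Fin n) :
    (μ - ν) ∘ s = μ ∘ s - ν ∘ s := rfl

lemma TMc (τ : ℕ → Module.End HR V) (n j : ℕ) (h : j + 1 < n) (i : Fin n) (hi1 : (i : ℕ) ≠ j) (hi2 : (i : ℕ) ≠ j + 1) :
    TM τ n j * shf V n (ee n i) = shf V n (ee n i) * TM τ n j := by
  apply end_ext; intro μ v
  have e1 : i ≠ (⟨j, Nat.lt_of_succ_lt h⟩ : Fin n) := fun e => hi1 (by rw [e])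
  have e2 : i ≠ (⟨j+1, h⟩ : Fin n) := fun e => hi2 (by rw [e])
  simp only [Module.End.mul_apply, shf_single, TM_single τ n j h, map_add, dem_c n j h i hi1 hi2]
  rw [add_comp', ee_comp, sgen_eq n j h, Equiv.swap_apply_of_ne_of_ne e1 e2]

lemma TMa (τ : ℕ → Module.End HR V) (n j : ℕ) (h : j + 1 < n) :
    TM τ n j * shf V n (ee n ⟨j, Nat.lt_of_succ_lt h⟩) =
      shf V n (ee n ⟨j+1,h⟩) * TM τ n j + (1 - tt) • shf V n (ee n ⟨j+1,h⟩) := by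
  apply end_ext; intro μ v
  simp only [Module.End.mul_apply, shf_single, TM_single τ n j h, map_add, dem_a n j h,
    LinearMap.add_apply, LinearMap.smul_apply]
  rw [add_comp', ee_comp, sgen_eq n j h, Equiv.swap_apply_left, add_assoc]

lemma TMab (τ : ℕ → Module.End HR V) (n j : ℕ) (h : j + 1 < n) :
    TM τ n j * shf V n (ee n ⟨j, Nat.lt_of_succ_lt h⟩ + ee n ⟨j+1,h⟩) =
      shf V n (ee n ⟨j, Nat.lt_of_succ_lt h⟩ + ee n ⟨j+1,h⟩) * TM τ n j := by
  apply end_ext; intro μ v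
  simp only [Module.End.mul_apply, shf_single, TM_single τ n j h, map_add, dem_ab n j h]
  rw [add_comp', add_comp', ee_comp, ee_comp, sgen_eq n j h, Equiv.swap_apply_left,
    Equiv.swap_apply_right, add_comm (ee n ⟨j+1,h⟩)]

lemma TMb (τ : ℕ → Module.End HR V) (n j : ℕ) (h : j + 1 < n) :
    TM τ n j * shf V n (ee n ⟨j+1,h⟩) =
      shf V n (ee n ⟨j, Nat.lt_of_succ_lt h⟩) * TM τ n j - (1 - tt) • shf V n (ee n ⟨j+1,h⟩) := by
  set a : Fin n := ⟨j, Nat.lt_of_succ_lt h⟩ with ha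
  set b : Fin n := ⟨j+1, h⟩ with hb
  have A := TMa τ n j h
  have AB := TMab τ n j h
  rw [← ha, ← hb] at A AB
  have hcomm : shf V n (ee n a) * shf V n (ee n b) = shf V n (ee n b) * shf V n (ee n a) := by
    rw [shf_mul, shf_mul, add_comm]
  have hinv : shf V n (ee n a) * shf V n (-ee n a) = 1 := by
    rw [shf_mul, add_neg_cancel, shf_zero]
  rw [← shf_mul] at AB
  have key : (TM τ n j * shf V n (ee n b)) * shf V n (ee n a) =
      (shf V n (ee n a) * TM τ n j - (1 - tt) • shf V n (ee n b)) * shf V n (ee n a) := by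
    rw [sub_mul, mul_assoc, mul_assoc _ (TM τ n j), A, ← hcomm, AB, mul_add, smul_mul_assoc,
      mul_smul_comm, hcomm, mul_assoc, ← hcomm]
    simp only [← mul_assoc]
    rw [hcomm]; abel
  have := congrArg (· * shf V n (-ee n a)) key
  simpa only [mul_assoc, hinv, mul_one] using this

end gen

section alg
set_option linter.unusedSimpArgs false
set_option linter.unusedSectionVars false
variable {A : Type} [Ring A] [Algebra HR A]

lemma alg_quad (T xa xb : A) (ha : T * xa = xb * T + (1 - tt) • xb)
    (hb : T * xb = xa * T - (1 - tt) • xb) :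
    (T * T - ((tt - 1) • T + tt • (1 : A))) * xa = xa * (T * T - ((tt - 1) • T + tt • (1 : A))) ∧
    (T * T - ((tt - 1) • T + tt • (1 : A))) * xb = xb * (T * T - ((tt - 1) • T + tt • (1 : A))) := by
  constructor <;>
  · simp only [mul_add, add_mul, mul_sub, sub_mul, smul_mul_assoc, mul_smul_comm, mul_assoc, ha, hb,
      mul_one, one_mul]
    simp only [mul_add, add_mul, mul_sub, sub_mul, smul_mul_assoc, mul_smul_comm, ← mul_assoc,
      ha, hb]
    module

lemma alg_quadc (T x : A) (h : T * x = x * T) :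
    (T * T - ((tt - 1) • T + tt • (1 : A))) * x = x * (T * T - ((tt - 1) • T + tt • (1 : A))) := by
  have h' : ∀ z, T * (x * z) = x * (T * z) := fun z => by rw [← mul_assoc, h, mul_assoc]
  simp only [mul_add, add_mul, mul_sub, sub_mul, smul_mul_assoc, mul_smul_comm, mul_assoc, h, h',
      mul_one, one_mul]

lemma alg_braid (T U x y z : A)
    (q1 : T * T = (tt - 1) • T + tt • (1 : A)) (q2 : U * U = (tt - 1) • U + tt • (1 : A))
    (h1 : T * x = y * T + (1 - tt) • y) (h2 : T * y = x * T - (1 - tt) • y) (h3 : T * z = z * T)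
    (k1 : U * x = x * U) (k2 : U * y = z * U + (1 - tt) • z) (k3 : U * z = y * U - (1 - tt) • z) :
    (T * U * T - U * T * U) * x = z * (T * U * T - U * T * U) ∧
    (T * U * T - U * T * U) * y = y * (T * U * T - U * T * U) ∧
    (T * U * T - U * T * U) * z = x * (T * U * T - U * T * U) := by
  have q1' : ∀ w, T * (T * w) = (tt - 1) • (T * w) + tt • w := fun w => by
    rw [← mul_assoc, q1, add_mul, smul_mul_assoc, smul_mul_assoc, one_mul]
  have q2' : ∀ w, U * (U * w) = (tt - 1) • (U * w) + tt • w := fun w => by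
    rw [← mul_assoc, q2, add_mul, smul_mul_assoc, smul_mul_assoc, one_mul]
  have h1' : ∀ w, T * (x * w) = y * (T * w) + (1 - tt) • (y * w) := fun w => by
    rw [← mul_assoc, h1, add_mul, smul_mul_assoc, mul_assoc]
  have h2' : ∀ w, T * (y * w) = x * (T * w) - (1 - tt) • (y * w) := fun w => by
    rw [← mul_assoc, h2, sub_mul, smul_mul_assoc, mul_assoc]
  have h3' : ∀ w, T * (z * w) = z * (T * w) := fun w => by
    rw [← mul_assoc, h3, mul_assoc]
  have k1' : ∀ w, U * (x * w) = x * (U * w) := fun w => by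
    rw [← mul_assoc, k1, mul_assoc]
  have k2' : ∀ w, U * (y * w) = z * (U * w) + (1 - tt) • (z * w) := fun w => by
    rw [← mul_assoc, k2, add_mul, smul_mul_assoc, mul_assoc]
  have k3' : ∀ w, U * (z * w) = y * (U * w) - (1 - tt) • (z * w) := fun w => by
    rw [← mul_assoc, k3, sub_mul, smul_mul_assoc, mul_assoc]
  refine ⟨?_, ?_, ?_⟩ <;>
  · simp only [mul_add, add_mul, mul_sub, sub_mul, smul_mul_assoc, mul_smul_comm, mul_assoc, h1, h2,
      h3, k1, k2, k3, h1', h2', h3', k1', k2', k3', q1, q2, q1', q2', mul_one, one_mul]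
    module

lemma alg_braidc (T U x : A) (h : T * x = x * T) (k : U * x = x * U) :
    (T * U * T - U * T * U) * x = x * (T * U * T - U * T * U) := by
  have h' : ∀ z, T * (x * z) = x * (T * z) := fun z => by rw [← mul_assoc, h, mul_assoc]
  have k' : ∀ z, U * (x * z) = x * (U * z) := fun z => by rw [← mul_assoc, k, mul_assoc]
  simp only [mul_sub, sub_mul, mul_assoc, h, h', k, k']

lemma alg_comm (T U x y : A)
    (h1 : T * x = y * T + (1 - tt) • y) (h2 : T * y = x * T - (1 - tt) • y)
    (k1 : U * x = x * U) (k2 : U * y = y * U) :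
    (T * U - U * T) * x = y * (T * U - U * T) ∧
    (T * U - U * T) * y = x * (T * U - U * T) := by
  have h1' : ∀ w, T * (x * w) = y * (T * w) + (1 - tt) • (y * w) := fun w => by
    rw [← mul_assoc, h1, add_mul, smul_mul_assoc, mul_assoc]
  have h2' : ∀ w, T * (y * w) = x * (T * w) - (1 - tt) • (y * w) := fun w => by
    rw [← mul_assoc, h2, sub_mul, smul_mul_assoc, mul_assoc]
  have k1' : ∀ w, U * (x * w) = x * (U * w) := fun w => by
    rw [← mul_assoc, k1, mul_assoc]
  have k2' : ∀ w, U * (y * w) = y * (U * w) := fun w => by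
    rw [← mul_assoc, k2, mul_assoc]
  refine ⟨?_, ?_⟩ <;>
  · simp only [mul_add, add_mul, mul_sub, sub_mul, smul_mul_assoc, mul_smul_comm, mul_assoc, h1, h2,
      k1, k2, h1', h2', k1', k2', mul_one, one_mul]
    module

lemma alg_commc (T U x : A) (h : T * x = x * T) (k : U * x = x * U) :
    (T * U - U * T) * x = x * (T * U - U * T) := by
  have h' : ∀ z, T * (x * z) = x * (T * z) := fun z => by rw [← mul_assoc, h, mul_assoc]
  have k' : ∀ z, U * (x * z) = x * (U * z) := fun z => by rw [← mul_assoc, k, mul_assoc]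
  simp only [mul_sub, sub_mul, mul_assoc, h, h', k, k']

lemma alg_negc (P Q x y : A) (h : (P - Q) * x = y * (P - Q)) : (Q - P) * x = y * (Q - P) := by
  rw [← neg_sub P Q, neg_mul, mul_neg, h]

/-- From the presentation: Bernstein relations. -/
lemma alg_bern (T x y : A) (q : T * T = (tt - 1) • T + tt • (1 : A))
    (h : T * x * T = tt • y) :
    T * x = y * T + (1 - tt) • y ∧ T * y = x * T - (1 - tt) • y := by
  have hu : LaurentPolynomial.T (-1) * tt = (1 : HR) := by
    rw [tt, ← LaurentPolynomial.T_add]; simp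
  have canc : ∀ a b : A, tt • a = tt • b → a = b := by
    intro a b hab
    have := congrArg (fun c => (LaurentPolynomial.T (-1) : HR) • c) hab
    simpa only [smul_smul, hu, one_smul] using this
  constructor
  · apply canc
    have e := congrArg (· * (T + (1 - tt) • (1 : A))) h
    simp only [mul_add, mul_assoc, q, mul_smul_comm, mul_one, smul_mul_assoc, smul_add] at e
    rw [smul_add, smul_comm tt (1 - tt), ← e]
    module
  · apply canc
    have e := congrArg (T * ·) h
    simp only [mul_smul_comm] at e
    rw [← e, ← mul_assoc, ← mul_assoc, q]
    simp only [add_mul, smul_mul_assoc, one_mul]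
    rw [h]
    module

end alg

section gen
variable {V : Type} [AddCommGroup V] [Module HR V]

structure HRep (n : ℕ) (τ : ℕ → Module.End HR V) : Prop where
  junk : ∀ j, ¬ j + 1 < n → τ j = 1
  quad : ∀ j, j + 1 < n → τ j * τ j = (tt - 1) • τ j + tt • (1 : Module.End HR V)
  braid : ∀ j, j + 2 < n → τ j * τ (j+1) * τ j = τ (j+1) * τ j * τ (j+1)
  comm : ∀ j k, j + 1 < k → k + 1 < n → τ j * τ k = τ k * τ j

variable {τ : ℕ → Module.End HR V} {n : ℕ}

lemma TM_quad (hτ : HRep n τ) (j : ℕ) (h : j + 1 < n) :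
    TM τ n j * TM τ n j = (tt - 1) • TM τ n j + tt • (1 : Module.End HR (MM n V)) := by
  rw [← sub_eq_zero]
  apply kill
  · intro v
    have := congrArg (fun A : Module.End HR V => A v) (hτ.quad j h)
    simp only [Module.End.mul_apply, LinearMap.add_apply, LinearMap.smul_apply,
      Module.End.one_apply] at this
    simp only [LinearMap.sub_apply, Module.End.mul_apply, LinearMap.add_apply, LinearMap.smul_apply,
      Module.End.one_apply, TM_zero τ n j (hτ.junk j), this, Finsupp.single_add,
      Finsupp.smul_single, sub_self]
  · intro i
    refine ⟨i, ?_⟩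
    by_cases h1 : (i : ℕ) = j
    · obtain rfl : i = ⟨j, Nat.lt_of_succ_lt h⟩ := Fin.ext h1
      exact (alg_quad _ _ _ (TMa τ n j h) (TMb τ n j h)).1
    by_cases h2 : (i : ℕ) = j + 1
    · obtain rfl : i = ⟨j+1, h⟩ := Fin.ext h2
      exact (alg_quad _ _ _ (TMa τ n j h) (TMb τ n j h)).2
    exact alg_quadc _ _ (TMc τ n j h i h1 h2)

lemma TM_braid (hτ : HRep n τ) (j : ℕ) (h : j + 2 < n) :
    TM τ n j * TM τ n (j+1) * TM τ n j = TM τ n (j+1) * TM τ n j * TM τ n (j+1) := by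
  rw [← sub_eq_zero]
  have hj : j + 1 < n := by omega
  apply kill
  · intro v
    have := congrArg (fun A : Module.End HR V => A v) (hτ.braid j h)
    simp only [Module.End.mul_apply] at this
    simp only [LinearMap.sub_apply, Module.End.mul_apply,
      TM_zero τ n j (hτ.junk j), TM_zero τ n (j+1) (hτ.junk (j+1)), this, sub_self]
  · intro i
    have key := alg_braid (TM τ n j) (TM τ n (j+1)) _ _ _ (TM_quad hτ j hj) (TM_quad hτ (j+1) h)
      (TMa τ n j hj) (TMb τ n j hj) (TMc τ n j hj ⟨j+2, h⟩ (by simp) (by simp))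
      (TMc τ n (j+1) h ⟨j, by omega⟩ (by simp) (by simp; omega)) (TMa τ n (j+1) h) (TMb τ n (j+1) h)
    by_cases h1 : (i : ℕ) = j
    · obtain rfl : i = ⟨j, Nat.lt_of_succ_lt hj⟩ := Fin.ext h1
      exact ⟨_, key.1⟩
    by_cases h2 : (i : ℕ) = j + 1
    · obtain rfl : i = ⟨j+1, hj⟩ := Fin.ext h2
      exact ⟨_, key.2.1⟩
    by_cases h3 : (i : ℕ) = j + 2
    · obtain rfl : i = ⟨j+2, h⟩ := Fin.ext h3
      exact ⟨_, key.2.2⟩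
    exact ⟨i, alg_braidc _ _ _ (TMc τ n j hj i h1 h2) (TMc τ n (j+1) h i h2 h3)⟩

lemma TM_comm (hτ : HRep n τ) (j k : ℕ) (hjk : j + 1 < k) (hk : k + 1 < n) :
    TM τ n j * TM τ n k = TM τ n k * TM τ n j := by
  rw [← sub_eq_zero]
  have hj : j + 1 < n := by omega
  apply kill
  · intro v
    have := congrArg (fun A : Module.End HR V => A v) (hτ.comm j k hjk hk)
    simp only [Module.End.mul_apply] at this
    simp only [LinearMap.sub_apply, Module.End.mul_apply,
      TM_zero τ n j (hτ.junk j), TM_zero τ n k (hτ.junk k), this, sub_self]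
  · intro i
    have key := alg_comm (TM τ n j) (TM τ n k) _ _ (TMa τ n j hj) (TMb τ n j hj)
      (TMc τ n k hk ⟨j, by omega⟩ (by simp; omega) (by simp; omega))
      (TMc τ n k hk ⟨j+1, by omega⟩ (by simp; omega) (by simp; omega))
    have key2 := alg_comm (TM τ n k) (TM τ n j) _ _ (TMa τ n k hk) (TMb τ n k hk)
      (TMc τ n j hj ⟨k, by omega⟩ (by simp; omega) (by simp; omega))
      (TMc τ n j hj ⟨k+1, by omega⟩ (by simp; omega) (by simp; omega))
    by_cases h1 : (i : ℕ) = j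
    · obtain rfl : i = ⟨j, Nat.lt_of_succ_lt hj⟩ := Fin.ext h1
      exact ⟨_, key.1⟩
    by_cases h2 : (i : ℕ) = j + 1
    · obtain rfl : i = ⟨j+1, hj⟩ := Fin.ext h2
      exact ⟨_, key.2⟩
    by_cases h3 : (i : ℕ) = k
    · obtain rfl : i = ⟨k, Nat.lt_of_succ_lt hk⟩ := Fin.ext h3
      refine ⟨⟨k+1, hk⟩, ?_⟩
      exact alg_negc _ _ _ _ key2.1
    by_cases h4 : (i : ℕ) = k + 1
    · obtain rfl : i = ⟨k+1, hk⟩ := Fin.ext h4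
      refine ⟨⟨k, Nat.lt_of_succ_lt hk⟩, ?_⟩
      exact alg_negc _ _ _ _ key2.2
    exact ⟨i, alg_commc _ _ _ (TMc τ n j hj i h1 h2) (TMc τ n k hk i h3 h4)⟩

/-- generator images -/
def repGen (τ : ℕ → Module.End HR V) (n : ℕ) : AGen n → Module.End HR (MM n V)
  | AGen.T j => TM τ n j
  | AGen.X i => shf V n (ee n i)
  | AGen.Xinv i => shf V n (-ee n i)

lemma rep_rel (hτ : HRep n τ) {x y : FA n} (h : ARel n x y) :
    FreeAlgebra.lift HR (repGen τ n) x = FreeAlgebra.lift HR (repGen τ n) y := by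
  induction h with
  | junk j h => simp [fT, repGen, TM, h]
  | quad j h =>
    simp only [fT, map_mul, map_add, map_smul, FreeAlgebra.lift_ι_apply, repGen, AlgHom.commutes,
      TM_quad hτ j h, Algebra.algebraMap_eq_smul_one, map_one]
  | braid j h =>
    simp only [fT, map_mul, FreeAlgebra.lift_ι_apply, repGen, TM_braid hτ j h]
  | commT j k hjk hk =>
    simp only [fT, map_mul, FreeAlgebra.lift_ι_apply, repGen, TM_comm hτ j k hjk hk]
  | commX i k =>
    simp only [fX, map_mul, FreeAlgebra.lift_ι_apply, repGen, shf_mul, add_comm]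
  | XinvL i =>
    simp only [fX, fXi, map_mul, FreeAlgebra.lift_ι_apply, repGen, shf_mul, add_neg_cancel, shf_zero,
      map_one]
  | XinvR i =>
    simp only [fX, fXi, map_mul, FreeAlgebra.lift_ι_apply, repGen, shf_mul, neg_add_cancel, shf_zero,
      map_one]
  | TXT j h =>
    simp only [fT, fX, map_mul, map_smul, FreeAlgebra.lift_ι_apply, repGen]
    rw [TMa τ n j h]
    simp only [add_mul, mul_assoc, TM_quad hτ j h, mul_add, mul_smul_comm, smul_mul_assoc, mul_one]
    module
  | TXcomm j h i h1 h2 =>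
    simp only [fT, fX, map_mul, FreeAlgebra.lift_ι_apply, repGen, TMc τ n j h i h1 h2]

/-- the representation -/
def rep (hτ : HRep n τ) : H n →ₐ[HR] Module.End HR (MM n V) :=
  RingQuot.liftAlgHom HR ⟨FreeAlgebra.lift HR (repGen τ n), fun _ _ h => rep_rel hτ h⟩

lemma rep_T (hτ : HRep n τ) (j : ℕ) : rep hτ (Tg n j) = TM τ n j := by
  simp [rep, Tg, fT, repGen]

lemma rep_X (hτ : HRep n τ) (i : Fin n) : rep hτ (Xg n i) = shf V n (ee n i) := by
  simp [rep, Xg, fX, repGen]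

lemma shf_list (l : List (Fin n → ℤ)) : (l.map (shf V n)).prod = shf V n l.sum := by
  induction l with
  | nil => simp [shf_zero]
  | cons a l ih => simp [ih, shf_mul]

lemma Xmon_vec (C : Finset (Fin n)) :
    Xmon n (vecOf n C) = ((List.finRange n).map fun i => if i ∈ C then Xg n i else 1).prod := by
  rw [Xmon, List.ofFn_eq_map]
  congr 2
  ext i
  by_cases h : i ∈ C <;> simp [vecOf, h]

lemma rep_Xmon (hτ : HRep n τ) (C : Finset (Fin n)) :
    rep hτ (Xmon n (vecOf n C)) = shf V n (vecOf n C) := by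
  rw [Xmon_vec, map_list_prod, List.map_map]
  have : (⇑(rep hτ) ∘ fun i => if i ∈ C then Xg n i else 1) =
      shf V n ∘ fun i => if i ∈ C then ee n i else 0 := by
    ext1 i
    by_cases h : i ∈ C <;> simp [h, rep_X, shf_zero]
  rw [this, ← List.map_map, shf_list]
  congr 1
  rw [← List.ofFn_eq_map, List.sum_ofFn]
  ext k
  rw [Finset.sum_apply, Finset.sum_eq_single k]
  · by_cases h : k ∈ C <;> simp [h, vecOf]
  · intro b _ hb
    by_cases h : b ∈ C <;> simp [h, Ne.symm hb]
  · simp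

end gen

section uniq
variable {A : Type} [Ring A] [Algebra HR A] {n : ℕ}

lemma hrep_of (φ : H n →ₐ[HR] A) : HRep n (fun j => LinearMap.mulLeft HR (φ (Tg n j))) where
  junk j h := by
    ext v; simp [Tg_junk n j h]
  quad j h := by
    ext v
    have := congrArg φ (Tg_quad n j h)
    simp only [map_mul, map_add, map_smul, map_one, AlgHom.commutes,
      Algebra.algebraMap_eq_smul_one tt] at this
    simp only [Module.End.mul_apply, LinearMap.mulLeft_apply, LinearMap.add_apply,
      LinearMap.smul_apply, Module.End.one_apply, ← mul_assoc, this, add_mul, smul_mul_assoc,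
      one_mul]
  braid j h := by
    ext v
    have := congrArg φ (Tg_braid n j h)
    simp only [map_mul] at this
    simp only [Module.End.mul_apply, LinearMap.mulLeft_apply, ← mul_assoc, this]
  comm j k h h' := by
    ext v
    have := congrArg φ (Tg_comm n j k h h')
    simp only [map_mul] at this
    simp only [Module.End.mul_apply, LinearMap.mulLeft_apply, ← mul_assoc, this]

lemma rep_fin (φ : H n →ₐ[HR] A) (h : H n) (hh : h ∈ Hfin n) :
    ∀ v, rep (hrep_of φ) h (Finsupp.single 0 v) = Finsupp.single 0 (φ h * v) := by
  rw [Hfin] at hh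
  induction hh using Algebra.adjoin_induction with
  | mem x hx =>
    obtain ⟨j, rfl⟩ := hx
    intro v
    rw [rep_T, TM_zero _ n j ((hrep_of φ).junk j)]; rfl
  | algebraMap r =>
    intro v
    rw [AlgHom.commutes, AlgHom.commutes, Module.algebraMap_end_apply, Finsupp.smul_single,
      Algebra.smul_def]
  | add x y _ _ hx hy =>
    intro v
    rw [map_add, map_add, LinearMap.add_apply, hx, hy, add_mul, Finsupp.single_add]
  | mul x y _ _ hx hy =>
    intro v
    rw [map_mul, map_mul, Module.End.mul_apply, hy, hx, mul_assoc]

lemma vecOf_inj {C D : Finset (Fin n)} (h : vecOf n C = vecOf n D) : C = D := by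
  ext i
  have := congrFun h i
  simp only [vecOf] at this
  by_cases h1 : i ∈ C <;> by_cases h2 : i ∈ D <;> simp_all

lemma uniq_gen (φ : H n →ₐ[HR] A) (S : Finset (Finset (Fin n))) (f g : Finset (Fin n) → H n)
    (hf : ∀ D ∈ S, f D ∈ Hfin n) (hg : ∀ D ∈ S, g D ∈ Hfin n)
    (h : ∑ D ∈ S, Xmon n (vecOf n D) * f D = ∑ D ∈ S, Xmon n (vecOf n D) * g D)
    (D : Finset (Fin n)) (hD : D ∈ S) : φ (f D) = φ (g D) := by
  have key : ∀ f : Finset (Fin n) → H n, (∀ D ∈ S, f D ∈ Hfin n) →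
      (rep (hrep_of φ) (∑ D ∈ S, Xmon n (vecOf n D) * f D) (Finsupp.single 0 1)) (vecOf n D)
        = φ (f D) := by
    intro f hf
    have : rep (hrep_of φ) (∑ D ∈ S, Xmon n (vecOf n D) * f D) (Finsupp.single 0 1) =
        ∑ D ∈ S, Finsupp.single (vecOf n D) (φ (f D)) := by
      rw [map_sum, LinearMap.sum_apply]
      apply Finset.sum_congr rfl
      intro C hC
      rw [map_mul, Module.End.mul_apply, rep_fin φ _ (hf C hC), rep_Xmon, shf_single, zero_add,
        mul_one]
    rw [this, Finsupp.finsetSum_apply, Finset.sum_eq_single D]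
    · simp
    · intro C _ hC
      rw [Finsupp.single_apply, if_neg]
      exact fun e => hC (vecOf_inj e)
    · exact fun e => absurd hD e
  rw [← key f hf, ← key g hg, h]

end uniq

lemma uniq_H {n : ℕ} (S : Finset (Finset (Fin n))) (f g : Finset (Fin n) → H n)
    (hf : ∀ D ∈ S, f D ∈ Hfin n) (hg : ∀ D ∈ S, g D ∈ Hfin n)
    (h : ∑ D ∈ S, Xmon n (vecOf n D) * f D = ∑ D ∈ S, Xmon n (vecOf n D) * g D)
    (D : Finset (Fin n)) (hD : D ∈ S) : f D = g D :=
  @uniq_gen (H n) (RingQuot.instRing (ARel n)) (RingQuot.instAlgebra (ARel n)) n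
    (AlgHom.id HR (H n)) S f g hf hg h D hD

/-! ### Bernstein relations in H -/

lemma H_bern (n j : ℕ) (h : j + 1 < n) :
    Tg n j * Xg n ⟨j, Nat.lt_of_succ_lt h⟩ = Xg n ⟨j+1,h⟩ * Tg n j + (1 - tt) • Xg n ⟨j+1,h⟩ ∧
    Tg n j * Xg n ⟨j+1,h⟩ = Xg n ⟨j, Nat.lt_of_succ_lt h⟩ * Tg n j - (1 - tt) • Xg n ⟨j+1,h⟩ := by
  refine @alg_bern (H n) (RingQuot.instRing (ARel n)) (RingQuot.instAlgebra (ARel n))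
    (Tg n j) _ _ ?_ (TXT' n j h)
  exact (Tg_quad n j h).trans (congrArg _ (Algebra.algebraMap_eq_smul_one _))

lemma list_ins {n : ℕ} (a : Fin n) (C : Finset (Fin n)) (ha : a ∉ C) (l : List (Fin n))
    (hl : l.Nodup) :
    (l.map fun i => if i ∈ insert a C then Xg n i else 1).prod =
      (if a ∈ l then Xg n a else 1) * (l.map fun i => if i ∈ C then Xg n i else 1).prod := by
  induction l with
  | nil => simp
  | cons b l ih =>
    have h2 := List.nodup_cons.1 hl
    rw [List.map_cons, List.prod_cons, List.map_cons, List.prod_cons, ih h2.2]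
    by_cases hb : b = a
    · subst hb
      simp [h2.1, ha]
    · have e : (a ∈ b :: l) ↔ a ∈ l := by simp [Ne.symm hb]
      have e2 : b ∈ insert a C ↔ b ∈ C := by simp [hb]
      simp only [e, e2]
      split_ifs <;> simp only [one_mul, ← mul_assoc, Xg_comm n a b]

lemma Xmon_ins {n : ℕ} (a : Fin n) (C : Finset (Fin n)) (ha : a ∉ C) :
    Xmon n (vecOf n (insert a C)) = Xg n a * Xmon n (vecOf n C) := by
  rw [Xmon_vec, Xmon_vec, list_ins a C ha _ (List.nodup_finRange n)]
  simp

lemma T_Xmon_comm (n j : ℕ) (h : j + 1 < n) (C : Finset (Fin n))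
    (h1 : (⟨j, Nat.lt_of_succ_lt h⟩ : Fin n) ∉ C) (h2 : (⟨j+1, h⟩ : Fin n) ∉ C) :
    Tg n j * Xmon n (vecOf n C) = Xmon n (vecOf n C) * Tg n j := by
  rw [Xmon_vec]
  have : Commute (Tg n j) ((List.finRange n).map fun i => if i ∈ C then Xg n i else 1).prod := by
    apply Commute.list_prod_right
    intro x hx
    obtain ⟨i, _, rfl⟩ := List.mem_map.1 hx
    by_cases hi : i ∈ C
    · simp only [hi, if_true]
      refine TXc n j h i ?_ ?_
      · rintro rfl; exact h1 hi
      · intro e; apply h2; convert hi; exact e.symm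
    · simp only [hi, if_false]; exact Commute.one_right _
  exact this

/-! ### Membership -/

section mem
variable {n : ℕ}

lemma tt_inv : LaurentPolynomial.T (-1) * tt = (1 : HR) := by
  rw [tt, ← LaurentPolynomial.T_add]; simp

lemma alg_inv {A : Type} [Ring A] [Algebra HR A] (T : A)
    (q : T * T = (tt - 1) • T + algebraMap HR A tt) :
    T * ((LaurentPolynomial.T (-1) : HR) • (T + algebraMap HR A (1 - tt))) = 1 ∧
    ((LaurentPolynomial.T (-1) : HR) • (T + algebraMap HR A (1 - tt))) * T = 1 := by
  simp only [Algebra.algebraMap_eq_smul_one] at *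
  constructor
  · rw [mul_smul_comm, mul_add, q, mul_smul_comm, mul_one]
    have : (tt - 1) • T + tt • (1:A) + (1 - tt) • T = tt • (1:A) := by module
    rw [this, smul_smul, tt_inv, one_smul]
  · rw [smul_mul_assoc, add_mul, q, smul_mul_assoc, one_mul]
    have : (tt - 1) • T + tt • (1:A) + (1 - tt) • T = tt • (1:A) := by module
    rw [this, smul_smul, tt_inv, one_smul]

lemma H_inv (j : ℕ) (h : j + 1 < n) :
    Tg n j * ((LaurentPolynomial.T (-1) : HR) • (Tg n j + algebraMap HR (H n) (1 - tt))) = 1 ∧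
    ((LaurentPolynomial.T (-1) : HR) • (Tg n j + algebraMap HR (H n) (1 - tt))) * Tg n j = 1 :=
  @alg_inv (H n) (RingQuot.instRing (ARel n)) (RingQuot.instAlgebra (ARel n)) (Tg n j)
    (Tg_quad n j h)

lemma Tg_mem (j : ℕ) : Tg n j ∈ Hfin n := Algebra.subset_adjoin ⟨j, rfl⟩

lemma Tg_unit (j : ℕ) : ∃ b ∈ Hfin n, Tg n j * b = 1 ∧ b * Tg n j = 1 := by
  by_cases h : j + 1 < n
  · refine ⟨_, ?_, H_inv j h⟩
    exact Subalgebra.smul_mem _ (Subalgebra.add_mem _ (Tg_mem j) (Subalgebra.algebraMap_mem _ _)) _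
  · exact ⟨1, Subalgebra.one_mem _, by simp [Tg_junk n j h]⟩

lemma inv_eq {R : Type} [MonoidWithZero R] {a b : R} (h : a * b = 1) (h' : b * a = 1) :
    Ring.inverse a = b :=
  Ring.inverse_unit (⟨a, b, h, h'⟩ : Rˣ)

lemma TofWord_unit (l : List ℕ) :
    TofWord n l ∈ Hfin n ∧ ∃ b ∈ Hfin n, TofWord n l * b = 1 ∧ b * TofWord n l = 1 := by
  induction l with
  | nil => exact ⟨by simpa [TofWord] using Subalgebra.one_mem _,
      1, Subalgebra.one_mem _, by simp [TofWord]⟩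
  | cons j l ih =>
    obtain ⟨h0, b, hb, h1, h2⟩ := ih
    obtain ⟨c, hc, h3, h4⟩ := Tg_unit (n := n) j
    have e : TofWord n (j :: l) = Tg n j * TofWord n l := by simp [TofWord]
    rw [e]
    refine ⟨Subalgebra.mul_mem _ (Tg_mem j) h0, b * c, Subalgebra.mul_mem _ hb hc, ?_, ?_⟩
    · rw [mul_assoc, ← mul_assoc _ b c, h1, one_mul, h3]
    · rw [mul_assoc, ← mul_assoc c, h4, one_mul, h2]

lemma Tw_mem (w : Equiv.Perm (Fin n)) : Tw n w ∈ Hfin n := (TofWord_unit _).1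

lemma Tw_inv_mem (w : Equiv.Perm (Fin n)) : Ring.inverse (Tw n w) ∈ Hfin n := by
  obtain ⟨b, hb, h1, h2⟩ := (TofWord_unit (n := n) (redWord n w)).2
  rw [Tw, inv_eq h1 h2]; exact hb

lemma paraCoeff_mem (h : H n) (C : Finset (Fin n)) : paraCoeff n C.card h C ∈ Hfin n := by
  rw [paraCoeff]
  split_ifs with hex
  · have := hex.choose_spec.1 C rfl
    refine (Submodule.span_le (p := Subalgebra.toSubmodule (Hfin n))).2 ?_ this
    rintro _ ⟨w, _, rfl⟩
    exact Tw_mem w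
  · exact Subalgebra.zero_mem _

lemma Psi_mem (C : Finset (Fin n)) (K : List (Finset (Fin n))) : Psi n (C :: K) ∈ Hfin n := by
  cases K with
  | nil =>
    rw [Psi]
    refine Subalgebra.mul_mem _ (Subalgebra.mul_mem _ (Subalgebra.algebraMap_mem _ _)
      (Tw_inv_mem _)) (Subalgebra.sum_mem _ fun w _ => Tw_mem w)
  | cons E K =>
    rw [Psi]
    · exact Subalgebra.mul_mem _ (Subalgebra.mul_mem _ (Subalgebra.algebraMap_mem _ _)
        (Tw_inv_mem _)) (paraCoeff_mem _ _)
    · simp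

end mem

lemma alg_sub_zero {A : Type} [Ring A] (x : A) : x - 0 = x := sub_zero x

lemma H_sub_zero {n : ℕ} (x : H n) : x - 0 = x :=
  @alg_sub_zero (H n) (RingQuot.instRing (ARel n)) x

lemma alg_one_sub {A : Type} [Ring A] [Algebra HR A] :
    1 - algebraMap HR A tt = algebraMap HR A (1 - tt) := by rw [map_sub, map_one]

lemma H_one_sub (n : ℕ) : 1 - algebraMap HR (H n) tt = algebraMap HR (H n) (1 - tt) :=
  @alg_one_sub (H n) (RingQuot.instRing (ARel n)) (RingQuot.instAlgebra (ARel n))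

lemma alg_sub_smul {A : Type} [Ring A] [Algebra HR A] (x y : A) :
    x - y = x + (-1 : HR) • y := by rw [neg_smul, one_smul, sub_eq_add_neg]

lemma H_sub_smul {n : ℕ} (x y : H n) : x - y = x + (-1 : HR) • y :=
  @alg_sub_smul (H n) (RingQuot.instRing (ARel n)) (RingQuot.instAlgebra (ARel n)) x y

section fin
variable {A : Type} [Ring A] [Algebra HR A]

lemma alg_T1 (T x y M : A) (h1 : T * x = y * T + (1 - tt) • y) (hM : T * M = M * T) :
    T * (x * M) = y * M * (T + (1 - algebraMap HR A tt)) := by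
  rw [← mul_assoc, h1, add_mul, mul_assoc, hM, mul_add, Algebra.algebraMap_eq_smul_one, mul_sub,
    mul_smul_comm, mul_one, smul_mul_assoc, mul_assoc, sub_smul, one_smul]

lemma alg_T2 (T x y M : A) (h2 : T * y = x * T - (1 - tt) • y) (hM : T * M = M * T) :
    T * (y * M) = x * M * T - (1 - algebraMap HR A tt) * (y * M) := by
  rw [← mul_assoc, h2, sub_mul, mul_assoc, hM, Algebra.algebraMap_eq_smul_one, sub_mul,
    smul_mul_assoc, one_mul, smul_mul_assoc, mul_assoc, sub_smul, one_smul]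
  simp

lemma alg_T3 (T x y M : A) (h1 : T * x = y * T + (1 - tt) • y)
    (h2 : T * y = x * T - (1 - tt) • y) (hxy : x * y = y * x) (hM : T * M = M * T) :
    T * (x * (y * M)) = x * (y * M) * T := by
  rw [← mul_assoc, h1, add_mul, mul_assoc, ← mul_assoc T, h2, sub_mul, mul_sub, mul_assoc x T, hM,
    smul_mul_assoc, smul_mul_assoc, mul_smul_comm, sub_add_cancel]
  simp only [← mul_assoc, hxy]

lemma alg_fin {α : Type} (S : Finset α) (s : α → α) (hs : ∀ C ∈ S, s C ∈ S)
    (hss : ∀ C, s (s C) = C) (X P : α → A) (c : α → Prop) (T : A)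
    (hT : ∀ C ∈ S, T * X C = X (s C) * (T + if c (s C) then 1 - algebraMap HR A tt else 0)
      - (if c C then 1 - algebraMap HR A tt else 0) * X C) :
    T * ∑ C ∈ S, X C * P C = ∑ D ∈ S, X D *
      ((T + if c D then 1 - algebraMap HR A tt else 0) * P (s D)
        - (if c D then 1 - algebraMap HR A tt else 0) * P D) := by
  have e1 : T * ∑ C ∈ S, X C * P C =
      ∑ C ∈ S, (X (s C) * (T + if c (s C) then 1 - algebraMap HR A tt else 0)) * P C
      - ∑ C ∈ S, ((if c C then 1 - algebraMap HR A tt else 0) * X C) * P C := by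
    rw [Finset.mul_sum, ← Finset.sum_sub_distrib]
    apply Finset.sum_congr rfl
    intro C hC
    rw [← mul_assoc, hT C hC, sub_mul]
  rw [e1]
  simp only [mul_sub, Finset.sum_sub_distrib]
  congr 1
  · apply Finset.sum_nbij' s s hs hs (fun C _ => hss C) (fun C _ => hss C)
    intro C _
    rw [hss, mul_assoc]
  · apply Finset.sum_congr rfl
    intro C _
    split_ifs
    · have : (1 - algebraMap HR A tt) * X C = X C * (1 - algebraMap HR A tt) := by
        rw [sub_mul, mul_sub, one_mul, mul_one, Algebra.commutes]
      rw [this, mul_assoc]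
    · simp

/-- final comparison -/
lemma alg_cmp (T P Q g f τ i : A) (hi : i = T + (1 - τ)) (c b1 b2 : Prop) [Decidable c]
    (hf : f = g + (1 - τ) * Q)
    (hg : g = (T + if c then 1 - τ else 0) * P - (if c then 1 - τ else 0) * Q)
    (hb1 : b1 → ¬ c → P = Q) (hb2 : b2 → ¬ c) :
    (b1 → f = i * P ∧ g = i * P - (1 - τ) * Q) ∧
    (b2 → f = T * P + (1 - τ) * Q ∧ g = T * P) := by
  subst hi
  refine ⟨fun hb => ?_, fun hb => ?_⟩
  · by_cases hc : c
    · rw [if_pos hc] at hg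
      subst hg; subst hf
      exact ⟨by abel, rfl⟩
    · rw [if_neg hc] at hg
      obtain rfl := hb1 hb hc
      subst hg; subst hf
      constructor <;> noncomm_ring
  · rw [if_neg (hb2 hb)] at hg
    subst hg; subst hf
    constructor <;> noncomm_ring

end fin

lemma mem_sCol (n j : ℕ) (C : Finset (Fin n)) (i : Fin n) :
    i ∈ sCol n j C ↔ sgen n j i ∈ C := by
  have hinv : ∀ x, sgen n j (sgen n j x) = x := by
    intro x
    by_cases h : j + 1 < n
    · rw [sgen_eq n j h]; simp
    · simp [sgen, h]
  rw [sCol, Finset.mem_image]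
  constructor
  · rintro ⟨a, ha, rfl⟩
    rwa [hinv]
  · intro h
    exact ⟨_, h, hinv i⟩

lemma sCol_card (n j : ℕ) (C : Finset (Fin n)) : (sCol n j C).card = C.card :=
  Finset.card_image_of_injective _ (sgen n j).injective

lemma sCol_sCol (n j : ℕ) (C : Finset (Fin n)) : sCol n j (sCol n j C) = C := by
  ext i
  rw [mem_sCol, mem_sCol]
  by_cases h : j + 1 < n
  · rw [sgen_eq n j h]; simp
  · simp [sgen, h]

lemma sCol_self (n j : ℕ) (h : j + 1 < n) (C : Finset (Fin n))
    (hc : (⟨j, Nat.lt_of_succ_lt h⟩ : Fin n) ∈ C ↔ (⟨j+1, h⟩ : Fin n) ∈ C) : sCol n j C = C := by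
  ext i
  rw [mem_sCol, sgen_eq n j h]
  by_cases h1 : i = ⟨j, Nat.lt_of_succ_lt h⟩
  · rw [h1, Equiv.swap_apply_left, hc]
  by_cases h2 : i = ⟨j+1, h⟩
  · rw [h2, Equiv.swap_apply_right, hc]
  rw [Equiv.swap_apply_of_ne_of_ne h1 h2]

lemma T_Xmon (n j : ℕ) (h : j + 1 < n) (C : Finset (Fin n)) (c : Finset (Fin n) → Prop)
    (hc : ∀ C, c C ↔ (⟨j, Nat.lt_of_succ_lt h⟩ : Fin n) ∉ C ∧ (⟨j+1, h⟩ : Fin n) ∈ C) :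
    Tg n j * Xmon n (vecOf n C) = Xmon n (vecOf n (sCol n j C)) *
      (Tg n j + if c (sCol n j C) then 1 - algebraMap HR (H n) tt else 0)
      - (if c C then 1 - algebraMap HR (H n) tt else 0) * Xmon n (vecOf n C) := by
  obtain ⟨B1, B2⟩ := H_bern n j h
  have X12 := Xg_comm n ⟨j, Nat.lt_of_succ_lt h⟩ ⟨j+1, h⟩
  have hcs : c (sCol n j C) ↔ (⟨j+1, h⟩ : Fin n) ∉ C ∧ (⟨j, Nat.lt_of_succ_lt h⟩ : Fin n) ∈ C := by
    rw [hc, mem_sCol, mem_sCol, sgen_eq n j h, Equiv.swap_apply_left, Equiv.swap_apply_right]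
  have hself := sCol_self n j h C
  have hms := mem_sCol n j C
  rw [sgen_eq n j h] at hms
  have hcc := hc C
  have TM0 := T_Xmon_comm n j h
  set a : Fin n := ⟨j, Nat.lt_of_succ_lt h⟩ with ha
  set b : Fin n := ⟨j+1, h⟩ with hb
  have hab : a ≠ b := by simp [ha, hb]
  have hM := TM0 ((C.erase a).erase b) (by simp) (by simp)
  by_cases h1 : a ∈ C <;> by_cases h2 : b ∈ C
  · have e : C = insert a (insert b ((C.erase a).erase b)) := by
      rw [Finset.insert_erase (Finset.mem_erase.2 ⟨hab.symm, h2⟩), Finset.insert_erase h1]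
    have hX : Xmon n (vecOf n C) = Xg n a * (Xg n b * Xmon n (vecOf n ((C.erase a).erase b))) := by
      rw [← Xmon_ins _ _ (by simp), ← Xmon_ins _ _ (by simp [hab]), ← e]
    have k1 : ¬ c (sCol n j C) := by rw [hcs]; tauto
    have k2 : ¬ c C := by rw [hcc]; tauto
    rw [if_neg k1, if_neg k2, hself (by tauto), zero_mul, H_sub_zero, add_zero, hX]
    exact @alg_T3 (H n) (RingQuot.instRing (ARel n)) (RingQuot.instAlgebra (ARel n)) _ _ _ _
      B1 B2 X12 hM
  · have e : C = insert a ((C.erase a).erase b) := by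
      rw [Finset.erase_eq_of_notMem (a := b) (by simp [h2]), Finset.insert_erase h1]
    have e' : sCol n j C = insert b ((C.erase a).erase b) := by
      ext i
      rw [hms]
      by_cases i1 : i = a
      · subst i1; simp [h2, hab]
      by_cases i2 : i = b
      · subst i2; simp [h1]
      rw [Equiv.swap_apply_of_ne_of_ne i1 i2]; simp [i1, i2]
    have hX : Xmon n (vecOf n C) = Xg n a * Xmon n (vecOf n ((C.erase a).erase b)) := by
      rw [← Xmon_ins _ _ (by simp), ← e]
    have hX' : Xmon n (vecOf n (sCol n j C)) =
        Xg n b * Xmon n (vecOf n ((C.erase a).erase b)) := by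
      rw [← Xmon_ins _ _ (by simp), ← e']
    have k1 : c (sCol n j C) := by rw [hcs]; tauto
    have k2 : ¬ c C := by rw [hcc]; tauto
    rw [if_pos k1, if_neg k2, zero_mul, H_sub_zero, hX, hX']
    exact @alg_T1 (H n) (RingQuot.instRing (ARel n)) (RingQuot.instAlgebra (ARel n)) _ _ _ _
      B1 hM
  · have e : C = insert b ((C.erase a).erase b) := by
      rw [Finset.erase_eq_of_notMem (a := a) h1, Finset.insert_erase h2]
    have e' : sCol n j C = insert a ((C.erase a).erase b) := by
      ext i
      rw [hms]
      by_cases i1 : i = a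
      · subst i1; simp [h2]
      by_cases i2 : i = b
      · subst i2; simp [h1, hab.symm]
      rw [Equiv.swap_apply_of_ne_of_ne i1 i2]; simp [i1, i2]
    have hX : Xmon n (vecOf n C) = Xg n b * Xmon n (vecOf n ((C.erase a).erase b)) := by
      rw [← Xmon_ins _ _ (by simp), ← e]
    have hX' : Xmon n (vecOf n (sCol n j C)) =
        Xg n a * Xmon n (vecOf n ((C.erase a).erase b)) := by
      rw [← Xmon_ins _ _ (by simp), ← e']
    have k1 : ¬ c (sCol n j C) := by rw [hcs]; tauto
    have k2 : c C := by rw [hcc]; tauto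
    rw [if_neg k1, if_pos k2, add_zero, hX, hX']
    exact @alg_T2 (H n) (RingQuot.instRing (ARel n)) (RingQuot.instAlgebra (ARel n)) _ _ _ _
      B2 hM
  · have k1 : ¬ c (sCol n j C) := by rw [hcs]; tauto
    have k2 : ¬ c C := by rw [hcc]; tauto
    rw [if_neg k1, if_neg k2, hself (by tauto), zero_mul, H_sub_zero, add_zero]
    exact TM0 C h1 h2

lemma tT_inv (n j : ℕ) (h : j + 1 < n) :
    tH n * Ring.inverse (Tg n j) = Tg n j + (1 - tH n) := by
  obtain ⟨h1, h2⟩ := H_inv (n := n) j h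
  rw [inv_eq h1 h2, tH, ← Algebra.smul_def, smul_smul, mul_comm tt, tt_inv, one_smul, map_sub,
    map_one]

lemma alg_addsum {A : Type} [Ring A] [Algebra HR A] {α : Type} (S : Finset α) (X P g : α → A)
    (T : A) (h : T * ∑ C ∈ S, X C * P C = ∑ D ∈ S, X D * g D) :
    (T + (1 - algebraMap HR A tt)) * ∑ C ∈ S, X C * P C =
      ∑ D ∈ S, X D * (g D + (1 - algebraMap HR A tt) * P D) := by
  rw [add_mul, h]
  simp only [mul_add, Finset.sum_add_distrib]
  congr 1
  rw [Finset.mul_sum]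
  apply Finset.sum_congr rfl
  intro C _
  rw [← mul_assoc, ← mul_assoc, sub_mul, mul_sub, one_mul, mul_one, Algebra.commutes]

/-- fundamental lemma: the coefficients `f_{D,K}` and `g_{D,K}` in the
expansions of `tT_j⁻¹ (Σ_C X^{⃗C} Ψ_{C⊗K})` and `T_j (Σ_C X^{⃗C} Ψ_{C⊗K})` are as stated,
according to the comparison of `s_jD` with `D`. -/
theorem stmt15 (n : ℕ) (hn : 1 ≤ n) (K : List (Finset (Fin n)))
    (hK : K.Chain' fun A B => B.card ≤ A.card)
    (hKpos : ∀ C ∈ K, 1 ≤ C.card)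
    (ℓ : ℕ) (h1 : 1 ≤ ℓ) (hℓn : ℓ ≤ n)
    (hhead : ∀ C ∈ K.head?, C.card ≤ ℓ)
    (j : ℕ) (hj : j + 1 < n)
    (f g : Finset (Fin n) → H n)
    (hfmem : ∀ D : Finset (Fin n), f D ∈ Hfin n)
    (hgmem : ∀ D : Finset (Fin n), g D ∈ Hfin n)
    (hf : tH n * Ring.inverse (Tg n j) *
        (∑ C ∈ colFinset n ℓ, Xmon n (vecOf n C) * Psi n (C :: K))
      = ∑ D ∈ colFinset n ℓ, Xmon n (vecOf n D) * f D)
    (hg : Tg n j * (∑ C ∈ colFinset n ℓ, Xmon n (vecOf n C) * Psi n (C :: K))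
      = ∑ D ∈ colFinset n ℓ, Xmon n (vecOf n D) * g D)
    (D : Finset (Fin n)) (hD : D.card = ℓ) :
    (((⟨j, by omega⟩ : Fin n) ∈ D → (⟨j + 1, hj⟩ : Fin n) ∈ D) →
      f D = tH n * Ring.inverse (Tg n j) * Psi n (sCol n j D :: K) ∧
      g D = tH n * Ring.inverse (Tg n j) * Psi n (sCol n j D :: K)
              - (1 - tH n) * Psi n (D :: K))
    ∧ (((⟨j + 1, hj⟩ : Fin n) ∈ D → (⟨j, by omega⟩ : Fin n) ∈ D) →
      f D = Tg n j * Psi n (sCol n j D :: K) + (1 - tH n) * Psi n (D :: K) ∧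
      g D = Tg n j * Psi n (sCol n j D :: K)) := by
  obtain ⟨c, hc⟩ : ∃ c : Finset (Fin n) → Prop, ∀ C, c C ↔
      ((⟨j, Nat.lt_of_succ_lt hj⟩ : Fin n) ∉ C ∧ (⟨j+1, hj⟩ : Fin n) ∈ C) :=
    ⟨_, fun _ => Iff.rfl⟩
  let g' : Finset (Fin n) → H n := fun D =>
    (Tg n j + if c D then 1 - algebraMap HR (H n) tt else 0) * Psi n (sCol n j D :: K)
        - (if c D then 1 - algebraMap HR (H n) tt else 0) * Psi n (D :: K)
  have hsub : (1 - algebraMap HR (H n) tt) ∈ Hfin n := by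
    rw [H_one_sub]
    exact Subalgebra.algebraMap_mem _ _
  have hif : ∀ D, (if c D then 1 - algebraMap HR (H n) tt else 0) ∈ Hfin n := by
    intro D
    split_ifs
    · exact hsub
    · exact Subalgebra.zero_mem _
  have hsubm : ∀ x y : H n, x ∈ Hfin n → y ∈ Hfin n → x - y ∈ Hfin n := by
    intro x y hx hy
    rw [H_sub_smul]
    exact Subalgebra.add_mem _ hx (Subalgebra.smul_mem _ hy _)
  have hg'mem : ∀ D, g' D ∈ Hfin n := fun D => hsubm _ _
    (Subalgebra.mul_mem _ (Subalgebra.add_mem _ (Tg_mem j) (hif D)) (Psi_mem _ _))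
    (Subalgebra.mul_mem _ (hif D) (Psi_mem _ _))
  have hS : ∀ C ∈ colFinset n ℓ, sCol n j C ∈ colFinset n ℓ := by
    intro C hC
    simp only [colFinset, Finset.mem_filter, Finset.mem_univ, true_and] at hC ⊢
    rw [sCol_card, hC]
  have hDS : D ∈ colFinset n ℓ := by simp [colFinset, hD]
  have main : Tg n j * (∑ C ∈ colFinset n ℓ, Xmon n (vecOf n C) * Psi n (C :: K)) =
      ∑ D ∈ colFinset n ℓ, Xmon n (vecOf n D) * g' D :=
    @alg_fin (H n) (RingQuot.instRing (ARel n)) (RingQuot.instAlgebra (ARel n)) _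
      (colFinset n ℓ) (sCol n j) hS (sCol_sCol n j) (fun C => Xmon n (vecOf n C))
      (fun C => Psi n (C :: K)) c (Tg n j)
      (fun C _ => T_Xmon n j hj C c hc)
  have main2 := @alg_addsum (H n) (RingQuot.instRing (ARel n)) (RingQuot.instAlgebra (ARel n)) _
      (colFinset n ℓ) (fun C => Xmon n (vecOf n C)) (fun C => Psi n (C :: K)) g' (Tg n j) main
  have hgD : g D = g' D := uniq_H (colFinset n ℓ) g g' (fun D _ => hgmem D) (fun D _ => hg'mem D)
    (hg.symm.trans main) D hDS
  have hfD : f D = g' D + (1 - algebraMap HR (H n) tt) * Psi n (D :: K) := by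
    refine uniq_H (colFinset n ℓ) f
      (fun D => g' D + (1 - algebraMap HR (H n) tt) * Psi n (D :: K)) (fun D _ => hfmem D)
      (fun D _ => Subalgebra.add_mem _ (hg'mem D) (Subalgebra.mul_mem _ hsub (Psi_mem _ _)))
      ?_ D hDS
    rw [tT_inv n j hj] at hf
    exact hf.symm.trans main2
  rw [← hgD] at hfD
  refine @alg_cmp (H n) (RingQuot.instRing (ARel n)) (RingQuot.instAlgebra (ARel n)) (Tg n j)
    (Psi n (sCol n j D :: K)) (Psi n (D :: K)) (g D) (f D) (tH n) _ (tT_inv n j hj) (c D) _ _ _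
    hfD hgD ?_ ?_
  · intro h1 h2
    rw [sCol_self n j hj D]
    refine ⟨h1, fun h3 => ?_⟩
    by_contra h4
    exact h2 ((hc D).2 ⟨h4, h3⟩)
  · intro h1 h2
    exact ((hc D).1 h2).1 (h1 ((hc D).1 h2).2)

end HLHecke
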